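/- arXiv:1612.01342 — 6 statements merged into one kernel-verified Lean document; each statement's English description precedes it below -/
import Mathlib

section
/- The function Φ(x) = (1/2)(F^m(x) + F^m_a(x)) is an exact potential for the charging game: for every agent i ∈ I, every x^{−i} (with each x^j ∈ X^j for j ≠ i), and every pair z^i, w^i ∈ X^i, f(z^i, x^{−i}) − f(w^i, x^{−i}) = Φ(z^i, x^{−i}) − Φ(w^i, x^{−i}). -/
/-- Agent `i`'s pay-off: `f(xⁱ, x⁻ⁱ) = Σ_t xⁱᵗ pᵗ (Σ_j xʲᵗ + x⁰ᵗ)`. -/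
noncomputable def payoff (h m : ℕ) (p x0 : Fin h → ℝ)
    (x : Fin m → Fin h → ℝ) (i : Fin m) : ℝ :=
  ∑ t, x i t * p t * ((∑ j, x j t) + x0 t)

/-- Social cost `F^m(x) = Σ_t pᵗ (Σ_i xⁱᵗ + x⁰ᵗ)²`. -/
noncomputable def Fsoc (h m : ℕ) (p x0 : Fin h → ℝ) (x : Fin m → Fin h → ℝ) : ℝ :=
  ∑ t, p t * ((∑ i, x i t) + x0 t) ^ 2

/-- Auxiliary cost `F^m_a(x) = Σ_i Σ_t pᵗ (xⁱᵗ)²`. -/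
noncomputable def Faux (h m : ℕ) (p : Fin h → ℝ) (x : Fin m → Fin h → ℝ) : ℝ :=
  ∑ i, ∑ t, p t * (x i t) ^ 2

/-- The sum over all agents of a function of their decisions, agent `i` playing `z`, splits into
agent `i`'s term and a remainder that does not depend on `z`. -/
theorem sum_update_eq_add_sum_erase {ι α M : Type*} [Fintype ι] [DecidableEq ι]
    [AddCommMonoid M] (g : α → M) (x : ι → α) (i : ι) (z : α) :
    ∑ j, g (Function.update x i z j) = g z + ∑ j ∈ Finset.univ.erase i, g (x j) := by
  rw [← Finset.add_sum_erase _ _ (Finset.mem_univ i), Function.update_self]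
  congr 1
  refine Finset.sum_congr rfl fun j hj => ?_
  rw [Function.update_of_ne (Finset.ne_of_mem_erase hj)]

/-- The potential exceeds agent `i`'s pay-off by its value when agent `i` plays `0`. -/
theorem half_Fsoc_add_Faux_update (h m : ℕ) (p x0 : Fin h → ℝ) (x : Fin m → Fin h → ℝ)
    (i : Fin m) (z : Fin h → ℝ) :
    1 / 2 * (Fsoc h m p x0 (Function.update x i z) + Faux h m p (Function.update x i z)) =
      payoff h m p x0 (Function.update x i z) i +
        1 / 2 * (Fsoc h m p x0 (Function.update x i 0) + Faux h m p (Function.update x i 0)) := by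
  have aggregate (y : Fin h → ℝ) (t : Fin h) :
      ∑ j, Function.update x i y j t = y t + ∑ j ∈ Finset.univ.erase i, x j t :=
    sum_update_eq_add_sum_erase (fun v : Fin h → ℝ => v t) x i y
  have auxiliary (y : Fin h → ℝ) : Faux h m p (Function.update x i y) =
      ∑ t, p t * y t ^ 2 + ∑ j ∈ Finset.univ.erase i, ∑ t, p t * x j t ^ 2 :=
    sum_update_eq_add_sum_erase (fun v : Fin h → ℝ => ∑ t, p t * v t ^ 2) x i y
  have social : 1 / 2 * (Fsoc h m p x0 (Function.update x i z) + ∑ t, p t * z t ^ 2) =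
      payoff h m p x0 (Function.update x i z) i +
        1 / 2 * Fsoc h m p x0 (Function.update x i 0) := by
    simp only [Fsoc, payoff, aggregate, Function.update_self, Pi.zero_apply,
      ← Finset.sum_add_distrib, Finset.mul_sum]
    exact Finset.sum_congr rfl fun t _ => by ring
  have vanish : ∑ t, p t * (0 : Fin h → ℝ) t ^ 2 = 0 := by simp
  rw [auxiliary z, auxiliary 0, vanish]
  linear_combination social

/-- `Φ(x) = (1/2)(F^m(x) + F^m_a(x))` is an exact potential for the
charging game: for every agent `i`, every `x⁻ⁱ` feasible for the other agents, and every
`zⁱ, wⁱ ∈ Xⁱ`, `f(zⁱ, x⁻ⁱ) - f(wⁱ, x⁻ⁱ) = Φ(zⁱ, x⁻ⁱ) - Φ(wⁱ, x⁻ⁱ)`. -/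
theorem stmt_4 (h m : ℕ) (hh : 0 < h) (hm : 0 < m)
    (p x0 : Fin h → ℝ) (hp : ∀ t, 0 ≤ p t) (hx0 : ∀ t, 0 ≤ x0 t)
    (X : Fin m → Set (Fin h → ℝ)) (hXne : ∀ i, (X i).Nonempty)
    (i : Fin m) (x : Fin m → Fin h → ℝ) (hx : ∀ j, j ≠ i → x j ∈ X j)
    (z w : Fin h → ℝ) (hz : z ∈ X i) (hw : w ∈ X i) :
    payoff h m p x0 (Function.update x i z) i - payoff h m p x0 (Function.update x i w) i =
      (1 / 2 * (Fsoc h m p x0 (Function.update x i z) + Faux h m p (Function.update x i z))) -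
      (1 / 2 * (Fsoc h m p x0 (Function.update x i w) + Faux h m p (Function.update x i w))) := by
  rw [half_Fsoc_add_Faux_update h m p x0 x i z, half_Fsoc_add_Faux_update h m p x0 x i w]
  ring
end

section
/- For every agent i ∈ I, every c > 0, and every x ∈ X, the minimizer over z^i ∈ X^i of F^m(z^i, x^{−i}) + F^m_a(z^i, x^{−i}) + 2c‖z^i − x^i‖² coincides with the minimizer over z^i ∈ X^i of f(z^i, x^{−i}) + c‖z^i − x^i‖²; that is, the regularized best-response maps T̃^i_a of the auxiliary centralized problem and T̃^i of the game are identical. -/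
/-- Squared Euclidean norm `‖y - y'‖²` of the difference of two vectors in `ℝ^h`. -/
noncomputable def sqDist (h : ℕ) (y y' : Fin h → ℝ) : ℝ :=
  ∑ t, (y t - y' t) ^ 2

/-- Replacing row `i` of `x` by `z` changes only the `i`-th summand of a sum over the rows. -/
theorem sum_update_row {ι α : Type*} [Fintype ι] [DecidableEq ι] (x : ι → α) (i : ι) (z : α)
    (g : α → ℝ) :
    ∑ j, g (Function.update x i z j) = g z + ∑ j ∈ Finset.univ.erase i, g (x j) := by
  rw [← Finset.add_sum_erase _ _ (Finset.mem_univ i), Function.update_self]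
  congr 1
  refine Finset.sum_congr rfl fun j hj => ?_
  rw [Function.update_of_ne (Finset.ne_of_mem_erase hj)]

/-- As a function of agent `i`'s decision, the sum of the social and the auxiliary cost is twice
agent `i`'s pay-off up to an additive constant. -/
theorem Fsoc_add_Faux_update (h m : ℕ) (p x0 : Fin h → ℝ) (x : Fin m → Fin h → ℝ) (i : Fin m)
    (z : Fin h → ℝ) :
    Fsoc h m p x0 (Function.update x i z) + Faux h m p (Function.update x i z) =
      2 * payoff h m p x0 (Function.update x i z) i +
        (∑ t, p t * ((∑ j ∈ Finset.univ.erase i, x j t) + x0 t) ^ 2 +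
          ∑ j ∈ Finset.univ.erase i, ∑ t, p t * (x j t) ^ 2) := by
  have hsum (t : Fin h) := sum_update_row x i z fun y => y t
  have haux := sum_update_row x i z fun y => ∑ t, p t * (y t) ^ 2
  simp only [Fsoc, Faux, payoff, hsum, haux, Function.update_self]
  rw [← add_assoc, ← add_assoc, add_left_inj, Finset.mul_sum, ← Finset.sum_add_distrib,
    ← Finset.sum_add_distrib]
  exact Finset.sum_congr rfl fun t _ => by ring

/-- For every agent `i`, every `c > 0` and every `x ∈ X`, the minimizer over
`zⁱ ∈ Xⁱ` of `F^m(zⁱ, x⁻ⁱ) + F^m_a(zⁱ, x⁻ⁱ) + 2c‖zⁱ - xⁱ‖²` coincides with the minimizer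
over `zⁱ ∈ Xⁱ` of `f(zⁱ, x⁻ⁱ) + c‖zⁱ - xⁱ‖²`: the regularized best-response maps `T̃ᵢₐ`
of the auxiliary centralized problem and `T̃ᵢ` of the game are identical. (A point of
`Xⁱ` is a minimizer of the first objective iff it is a minimizer of the second.) -/
theorem stmt_5 (h m : ℕ) (hh : 0 < h) (hm : 0 < m)
    (p x0 : Fin h → ℝ) (hp : ∀ t, 0 ≤ p t) (hx0 : ∀ t, 0 ≤ x0 t)
    (X : Fin m → Set (Fin h → ℝ))
    (hXne : ∀ i, (X i).Nonempty)
    (hXcpt : ∀ i, IsCompact (X i))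
    (hXcvx : ∀ i, Convex ℝ (X i))
    (i : Fin m) (c : ℝ) (hc : 0 < c)
    (x : Fin m → Fin h → ℝ) (hx : ∀ j, x j ∈ X j)
    (za : Fin h → ℝ) (hza : za ∈ X i) :
    (∀ w ∈ X i,
        Fsoc h m p x0 (Function.update x i za) + Faux h m p (Function.update x i za) +
            2 * c * sqDist h za (x i) ≤
          Fsoc h m p x0 (Function.update x i w) + Faux h m p (Function.update x i w) +
            2 * c * sqDist h w (x i)) ↔
      (∀ w ∈ X i,
        payoff h m p x0 (Function.update x i za) i + c * sqDist h za (x i) ≤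
          payoff h m p x0 (Function.update x i w) i + c * sqDist h w (x i)) := by
  simp only [Fsoc_add_Faux_update]
  exact forall₂_congr fun w _ => by constructor <;> intro hw <;> linarith
end

section
/- The set of Nash equilibria N of the charging game coincides with the set of minimizers over X of the auxiliary objective F^m(x) + F^m_a(x); that is, N = argmin_{x ∈ X} [F^m(x) + F^m_a(x)]. -/
/-- Constraint set `Xⁱ = {y ∈ ℝ^h : Σ_t yᵗ = γ, yᵗ ∈ [loᵗ, hiᵗ] ∀t}`. -/
def Xset (h : ℕ) (γ : ℝ) (lo hi : Fin h → ℝ) : Set (Fin h → ℝ) :=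
  {y | (∑ t, y t) = γ ∧ ∀ t, y t ∈ Set.Icc (lo t) (hi t)}

/-- The directional derivative at `x` of agent `i`'s pay-off along a change `d` of its own decision. -/
noncomputable def payoffSlope (h m : ℕ) (p x0 : Fin h → ℝ)
    (x : Fin m → Fin h → ℝ) (i : Fin m) (d : Fin h → ℝ) : ℝ :=
  ∑ t, p t * d t * ((∑ j, x j t) + x0 t + x i t)

lemma sum_update_add {h m : ℕ} (x : Fin m → Fin h → ℝ) (i : Fin m) (d : Fin h → ℝ) (t : Fin h) :
    ∑ j, Function.update x i (x i + d) j t = (∑ j, x j t) + d t := by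
  rw [← Finset.add_sum_erase _ _ (Finset.mem_univ i),
    ← Finset.add_sum_erase _ (fun j => x j t) (Finset.mem_univ i),
    Finset.sum_congr rfl fun j hj => by
      rw [Function.update_of_ne (Finset.ne_of_mem_erase hj)]]
  simp only [Function.update_self, Pi.add_apply]
  ring

lemma payoff_update_add {h m : ℕ} (p x0 : Fin h → ℝ) (x : Fin m → Fin h → ℝ) (i : Fin m)
    (d : Fin h → ℝ) :
    payoff h m p x0 (Function.update x i (x i + d)) i =
      payoff h m p x0 x i + payoffSlope h m p x0 x i d + ∑ t, p t * d t ^ 2 := by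
  simp only [payoff, payoffSlope, sum_update_add, Function.update_self, Pi.add_apply,
    ← Finset.sum_add_distrib]
  exact Finset.sum_congr rfl fun t _ => by ring

lemma Fsoc_update_add {h m : ℕ} (p x0 : Fin h → ℝ) (x : Fin m → Fin h → ℝ) (i : Fin m)
    (d : Fin h → ℝ) :
    Fsoc h m p x0 (Function.update x i (x i + d)) =
      Fsoc h m p x0 x + ∑ t, p t * (2 * d t * ((∑ j, x j t) + x0 t) + d t ^ 2) := by
  simp only [Fsoc, sum_update_add, ← Finset.sum_add_distrib]
  exact Finset.sum_congr rfl fun t _ => by ring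

lemma Faux_update_add {h m : ℕ} (p : Fin h → ℝ) (x : Fin m → Fin h → ℝ) (i : Fin m)
    (d : Fin h → ℝ) :
    Faux h m p (Function.update x i (x i + d)) =
      Faux h m p x + ∑ t, p t * (2 * d t * x i t + d t ^ 2) := by
  have others : ∀ j ∈ Finset.univ.erase i,
      ∑ t, p t * Function.update x i (x i + d) j t ^ 2 = ∑ t, p t * x j t ^ 2 := fun j hj => by
    rw [Function.update_of_ne (Finset.ne_of_mem_erase hj)]
  simp only [Faux]
  rw [← Finset.add_sum_erase _ _ (Finset.mem_univ i),
    ← Finset.add_sum_erase _ (fun j => ∑ t, p t * x j t ^ 2) (Finset.mem_univ i),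
    Finset.sum_congr rfl others, add_right_comm, ← Finset.sum_add_distrib]
  congr 1
  refine Finset.sum_congr rfl fun t _ => ?_
  simp only [Function.update_self, Pi.add_apply]
  ring

/-- A unilateral deviation changes `F^m + F^m_a` by twice the change of the deviator's pay-off. -/
lemma potential_update_sub {h m : ℕ} (p x0 : Fin h → ℝ) (x : Fin m → Fin h → ℝ) (i : Fin m)
    (ζ : Fin h → ℝ) :
    (Fsoc h m p x0 (Function.update x i ζ) + Faux h m p (Function.update x i ζ)) -
        (Fsoc h m p x0 x + Faux h m p x) =
      2 * (payoff h m p x0 (Function.update x i ζ) i - payoff h m p x0 x i) := by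
  obtain ⟨d, rfl⟩ : ∃ d, ζ = x i + d := ⟨ζ - x i, by abel⟩
  have key : (∑ t, p t * (2 * d t * ((∑ j, x j t) + x0 t) + d t ^ 2)) +
      ∑ t, p t * (2 * d t * x i t + d t ^ 2) =
      2 * (payoffSlope h m p x0 x i d + ∑ t, p t * d t ^ 2) := by
    simp only [payoffSlope, ← Finset.sum_add_distrib, Finset.mul_sum]
    exact Finset.sum_congr rfl fun t _ => by ring
  rw [payoff_update_add, Fsoc_update_add, Faux_update_add]
  linarith

/-- First-order lower bound expressing the convexity of `F^m + F^m_a`. -/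
lemma potential_add_slope_le {h m : ℕ} (p x0 : Fin h → ℝ) (hp : ∀ t, 0 ≤ p t)
    (x y : Fin m → Fin h → ℝ) :
    Fsoc h m p x0 x + Faux h m p x + 2 * ∑ i, payoffSlope h m p x0 x i (y i - x i) ≤
      Fsoc h m p x0 y + Faux h m p y := by
  simp only [Fsoc, Faux, payoffSlope]
  rw [Finset.sum_comm (γ := Fin m), Finset.sum_comm (γ := Fin m), Finset.sum_comm (γ := Fin m),
    Finset.mul_sum, ← Finset.sum_add_distrib, ← Finset.sum_add_distrib, ← Finset.sum_add_distrib]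
  refine Finset.sum_le_sum fun t _ => ?_
  have slope : ∑ i, p t * (y i - x i) t * ((∑ j, x j t) + x0 t + x i t) =
      p t * (((∑ i, y i t) - ∑ i, x i t) * ((∑ j, x j t) + x0 t)) +
        ∑ i, p t * ((y i t - x i t) * x i t) := by
    rw [← Finset.sum_sub_distrib, Finset.sum_mul, Finset.mul_sum, ← Finset.sum_add_distrib]
    exact Finset.sum_congr rfl fun i _ => by simp only [Pi.sub_apply]; ring
  have own : ∑ i, p t * x i t ^ 2 + 2 * ∑ i, p t * ((y i t - x i t) * x i t) ≤
      ∑ i, p t * y i t ^ 2 := by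
    rw [Finset.mul_sum, ← Finset.sum_add_distrib]
    refine Finset.sum_le_sum fun i _ => ?_
    linarith [mul_nonneg (hp t) (sq_nonneg (y i t - x i t))]
  rw [slope]
  linarith [mul_nonneg (hp t) (sq_nonneg ((∑ i, y i t) - ∑ i, x i t))]

lemma convex_Xset (h : ℕ) (γ : ℝ) (lo hi : Fin h → ℝ) : Convex ℝ (Xset h γ lo hi) := by
  rintro y ⟨hy, hy'⟩ z ⟨hz, hz'⟩ a b ha hb hab
  refine ⟨?_, fun t => convex_Icc _ _ (hy' t) (hz' t) ha hb hab⟩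
  simp only [Pi.add_apply, Pi.smul_apply, smul_eq_mul, Finset.sum_add_distrib,
    ← Finset.mul_sum, hy, hz]
  rw [← add_mul, hab, one_mul]

lemma nonneg_of_forall_mul_add_sq_nonneg {a b : ℝ}
    (hab : ∀ ε : ℝ, 0 < ε → ε ≤ 1 → 0 ≤ ε * a + ε ^ 2 * b) : 0 ≤ a := by
  have lim : Filter.Tendsto (fun ε : ℝ => a + ε * b) (nhdsWithin 0 (Set.Ioi 0)) (nhds a) := by
    have : Continuous fun ε : ℝ => a + ε * b := by fun_prop
    simpa using (this.tendsto 0).mono_left nhdsWithin_le_nhds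
  refine ge_of_tendsto lim ?_
  filter_upwards [Ioc_mem_nhdsGT (zero_lt_one' ℝ)] with ε hε
  refine nonneg_of_mul_nonneg_right (a := ε) ?_ hε.1
  linarith [hab ε hε.1 hε.2]

/-- A best response over a convex set has nonnegative slope towards every feasible decision. -/
lemma payoffSlope_nonneg_of_best_response {h m : ℕ} {p x0 : Fin h → ℝ} {x : Fin m → Fin h → ℝ}
    {i : Fin m} {s : Set (Fin h → ℝ)} (hs : Convex ℝ s) (hx : x i ∈ s)
    (hbest : ∀ ζ ∈ s, payoff h m p x0 x i ≤ payoff h m p x0 (Function.update x i ζ) i)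
    {ζ : Fin h → ℝ} (hζ : ζ ∈ s) : 0 ≤ payoffSlope h m p x0 x i (ζ - x i) := by
  refine nonneg_of_forall_mul_add_sq_nonneg (b := ∑ t, p t * (ζ - x i) t ^ 2)
    fun ε hε hε1 => ?_
  have dev := hbest _ (hs.add_smul_sub_mem hx hζ ⟨hε.le, hε1⟩)
  rw [payoff_update_add] at dev
  have slope : payoffSlope h m p x0 x i (ε • (ζ - x i)) =
      ε * payoffSlope h m p x0 x i (ζ - x i) := by
    simp only [payoffSlope, Finset.mul_sum, Pi.smul_apply, smul_eq_mul]
    exact Finset.sum_congr rfl fun t _ => by ring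
  have quad : ∑ t, p t * (ε • (ζ - x i)) t ^ 2 = ε ^ 2 * ∑ t, p t * (ζ - x i) t ^ 2 := by
    simp only [Finset.mul_sum, Pi.smul_apply, smul_eq_mul]
    exact Finset.sum_congr rfl fun t _ => by ring
  linarith

/-- The set of Nash equilibria `N` of the charging game coincides with the
set of minimizers over `X = X¹ × ⋯ × Xᵐ` of the auxiliary objective `F^m + F^m_a`. -/
theorem stmt_6 (h m : ℕ) (hh : 0 < h) (hm : 0 < m)
    (p x0 : Fin h → ℝ) (hp : ∀ t, 0 ≤ p t) (hx0 : ∀ t, 0 ≤ x0 t)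
    (γ : Fin m → ℝ) (lo hi : Fin m → Fin h → ℝ)
    (hγ : ∀ i, 0 < γ i) (hlo : ∀ i t, 0 ≤ lo i t) (hlohi : ∀ i t, lo i t ≤ hi i t)
    (hXne : ∀ i, (Xset h (γ i) (lo i) (hi i)).Nonempty) :
    {x : Fin m → Fin h → ℝ | (∀ i, x i ∈ Xset h (γ i) (lo i) (hi i)) ∧
        ∀ i, ∀ ζ ∈ Xset h (γ i) (lo i) (hi i),
          payoff h m p x0 x i ≤ payoff h m p x0 (Function.update x i ζ) i} =
      {x : Fin m → Fin h → ℝ | (∀ i, x i ∈ Xset h (γ i) (lo i) (hi i)) ∧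
        ∀ y : Fin m → Fin h → ℝ, (∀ i, y i ∈ Xset h (γ i) (lo i) (hi i)) →
          Fsoc h m p x0 x + Faux h m p x ≤ Fsoc h m p x0 y + Faux h m p y} := by
  ext x
  refine and_congr_right fun hx => ⟨fun hN y hy => ?_, fun hmin i ζ hζ => ?_⟩
  · have slope : 0 ≤ ∑ i, payoffSlope h m p x0 x i (y i - x i) :=
      Finset.sum_nonneg fun i _ =>
        payoffSlope_nonneg_of_best_response (convex_Xset _ _ _ _) (hx i) (hN i) (hy i)
    linarith [potential_add_slope_le p x0 hp x y]
  · have feasible : ∀ j, Function.update x i ζ j ∈ Xset h (γ j) (lo j) (hi j) := by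
      intro j
      rcases eq_or_ne j i with rfl | hj
      · simpa using hζ
      · simpa [hj] using hx j
    linarith [hmin _ feasible, potential_update_sub p x0 x i ζ]
end

section
/- If p^t > 0 for all t ∈ H, then for any feasible points x ∈ X and x_a ∈ X, the ratio of the auxiliary cost of x_a to the social cost of x satisfies F^m_a(x_a) / F^m(x) ≤ (p̄ · h · Σ_{i∈I} (γ^i)²) / (p̲ · (Σ_{i∈I} γ^i)²), where p̄ = max_{t∈H} p^t and p̲ = min_{t∈H} p^t. -/
lemma Faux_le {h m : ℕ} {p : Fin h → ℝ} {P : ℝ} (hP : 0 ≤ P) (hpP : ∀ t, p t ≤ P)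
    {x : Fin m → Fin h → ℝ} (hx : ∀ i t, 0 ≤ x i t) :
    Faux h m p x ≤ P * ∑ i, (∑ t, x i t) ^ 2 := by
  rw [Faux, Finset.mul_sum]
  refine Finset.sum_le_sum fun i _ => ?_
  calc ∑ t, p t * x i t ^ 2 ≤ ∑ t, P * x i t ^ 2 :=
        Finset.sum_le_sum fun t _ => mul_le_mul_of_nonneg_right (hpP t) (sq_nonneg _)
    _ = P * ∑ t, x i t ^ 2 := (Finset.mul_sum ..).symm
    _ ≤ P * (∑ t, x i t) ^ 2 :=
        mul_le_mul_of_nonneg_left (Finset.sum_sq_le_sq_sum_of_nonneg fun t _ => hx i t) hP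

lemma mul_sq_sum_le_Fsoc {h m : ℕ} {p x0 : Fin h → ℝ} {q : ℝ} (hq : 0 ≤ q)
    (hqp : ∀ t, q ≤ p t) (hx0 : ∀ t, 0 ≤ x0 t)
    {x : Fin m → Fin h → ℝ} (hx : ∀ i t, 0 ≤ x i t) :
    q * (∑ i, ∑ t, x i t) ^ 2 ≤ h * Fsoc h m p x0 x := by
  have hs : ∀ t, 0 ≤ ∑ i, x i t := fun t => Finset.sum_nonneg fun i _ => hx i t
  have hcs : (∑ t, ∑ i, x i t) ^ 2 ≤ h * ∑ t, (∑ i, x i t) ^ 2 := by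
    simpa using sq_sum_le_card_mul_sum_sq (s := Finset.univ) (f := fun t => ∑ i, x i t)
  have hF : q * ∑ t, (∑ i, x i t) ^ 2 ≤ Fsoc h m p x0 x := by
    rw [Fsoc, Finset.mul_sum]
    refine Finset.sum_le_sum fun t _ => ?_
    exact mul_le_mul (hqp t)
      (pow_le_pow_left₀ (hs t) (le_add_of_nonneg_right (hx0 t)) 2) (sq_nonneg _)
      (hq.trans (hqp t))
  rw [Finset.sum_comm]
  calc q * (∑ t, ∑ i, x i t) ^ 2 ≤ q * (h * ∑ t, (∑ i, x i t) ^ 2) :=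
        mul_le_mul_of_nonneg_left hcs hq
    _ = h * (q * ∑ t, (∑ i, x i t) ^ 2) := by ring
    _ ≤ h * Fsoc h m p x0 x := mul_le_mul_of_nonneg_left hF h.cast_nonneg

/-- If `pᵗ > 0` for all `t`, then for any feasible `x, x_a ∈ X`,
`F^m_a(x_a) / F^m(x) ≤ (p̄ h Σ_i (γⁱ)²) / (p̲ (Σ_i γⁱ)²)`, where `p̄ = max_t pᵗ` and
`p̲ = min_t pᵗ`. -/
theorem stmt_9 (h m : ℕ) (hh : 0 < h) (hm : 0 < m)
    (p x0 : Fin h → ℝ) (hp : ∀ t, 0 < p t) (hx0 : ∀ t, 0 ≤ x0 t)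
    (γ : Fin m → ℝ) (lo hi : Fin m → Fin h → ℝ)
    (hγ : ∀ i, 0 < γ i) (hlo : ∀ i t, 0 ≤ lo i t) (hlohi : ∀ i t, lo i t ≤ hi i t)
    (hXne : ∀ i, (Xset h (γ i) (lo i) (hi i)).Nonempty)
    (x xa : Fin m → Fin h → ℝ)
    (hx : ∀ i, x i ∈ Xset h (γ i) (lo i) (hi i))
    (hxa : ∀ i, xa i ∈ Xset h (γ i) (lo i) (hi i)) :
    Faux h m p xa / Fsoc h m p x0 x ≤
      Finset.univ.sup' (Finset.univ_nonempty_iff.mpr (Fin.pos_iff_nonempty.mp hh)) p *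
          h * (∑ i, (γ i) ^ 2) /
        (Finset.univ.inf' (Finset.univ_nonempty_iff.mpr (Fin.pos_iff_nonempty.mp hh)) p *
          (∑ i, γ i) ^ 2) := by
  have hne : (Finset.univ : Finset (Fin h)).Nonempty :=
    Finset.univ_nonempty_iff.mpr (Fin.pos_iff_nonempty.mp hh)
  have hpP : ∀ t, p t ≤ Finset.univ.sup' hne p := fun t =>
    Finset.le_sup' p (Finset.mem_univ t)
  have hqp : ∀ t, Finset.univ.inf' hne p ≤ p t := fun t =>
    Finset.inf'_le p (Finset.mem_univ t)
  have hq : 0 < Finset.univ.inf' hne p := (Finset.lt_inf'_iff hne).mpr fun t _ => hp t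
  have hP : 0 < Finset.univ.sup' hne p := (hp ⟨0, hh⟩).trans_le (hpP _)
  have hA := Faux_le hP.le hpP fun i t => (hlo i t).trans ((hxa i).2 t).1
  have hS := mul_sq_sum_le_Fsoc hq.le hqp hx0 fun i t => (hlo i t).trans ((hx i).2 t).1
  simp only [(hxa _).1] at hA
  simp only [(hx _).1] at hS
  have hG : 0 < ∑ i, γ i :=
    Finset.sum_pos (fun i _ => hγ i) (Finset.univ_nonempty_iff.mpr (Fin.pos_iff_nonempty.mp hm))
  have hD : 0 < Finset.univ.inf' hne p * (∑ i, γ i) ^ 2 := mul_pos hq (pow_pos hG 2)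
  have hF : 0 < Fsoc h m p x0 x := pos_of_mul_pos_right (hD.trans_le hS) h.cast_nonneg
  rw [div_le_div_iff₀ hF hD]
  calc Faux h m p xa * (Finset.univ.inf' hne p * (∑ i, γ i) ^ 2)
      ≤ (Finset.univ.sup' hne p * ∑ i, γ i ^ 2) * (h * Fsoc h m p x0 x) :=
        mul_le_mul hA hS hD.le (mul_nonneg hP.le (Finset.sum_nonneg fun i _ => sq_nonneg _))
    _ = Finset.univ.sup' hne p * h * (∑ i, γ i ^ 2) * Fsoc h m p x0 x := by ring
end

section
/- (Abstraction into homogeneous groups, auxiliary problem.) Suppose the index set I is partitioned into groups I^1, …, I^{n} such that all agents in group ℓ share the same constraint set X̄^ℓ. Let x̄_a⋆ = (x̄_a^{1,⋆},…,x̄_a^{n,⋆}) be any minimizer of the reduced auxiliary objective F̄^m(x̄) + Σ_ℓ |I^ℓ| Σ_{t∈H} p^t (x̄^{ℓt})² over X̄^1 × … × X̄^{n}, where F̄^m(x̄) = Σ_{t∈H} p^t (Σ_ℓ |I^ℓ| x̄^{ℓt} + x^{0t})². Define x_a⋆ ∈ X by x_a^{i,⋆} = x̄_a^{ℓ,⋆}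 for every i ∈ I^ℓ and every ℓ. Then x_a⋆ is a minimizer of F^m + F^m_a over X; in particular, agents in the same homogeneous group have identical decision vectors at this minimizer (which is the Nash equilibrium when p^t > 0 for all t). -/
/-- Reduced social cost `F̄^m(x̄) = Σ_t pᵗ (Σ_ℓ |I^ℓ| x̄^{ℓt} + x⁰ᵗ)²`. -/
noncomputable def Fbar (h n : ℕ) (p x0 : Fin h → ℝ) (cnt : Fin n → ℕ)
    (xb : Fin n → Fin h → ℝ) : ℝ :=
  ∑ t, p t * ((∑ ℓ, (cnt ℓ : ℝ) * xb ℓ t) + x0 t) ^ 2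

/-- Reduced auxiliary cost `Σ_ℓ |I^ℓ| Σ_t pᵗ (x̄^{ℓt})²`. -/
noncomputable def FbarAux (h n : ℕ) (p : Fin h → ℝ) (cnt : Fin n → ℕ)
    (xb : Fin n → Fin h → ℝ) : ℝ :=
  ∑ ℓ, (cnt ℓ : ℝ) * ∑ t, p t * (xb ℓ t) ^ 2

/-- The arithmetic mean of a nonempty finite family in `Xset` stays in `Xset`. -/
theorem mean_mem_Xset {ι : Type*} {h : ℕ} {γ : ℝ} {lo hi : Fin h → ℝ} {s : Finset ι}
    (hs : s.Nonempty) {y : ι → Fin h → ℝ} (hy : ∀ i ∈ s, y i ∈ Xset h γ lo hi) :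
    (fun t => (∑ i ∈ s, y i t) / s.card) ∈ Xset h γ lo hi := by
  have hc : (0 : ℝ) < s.card := by exact_mod_cast hs.card_pos
  refine ⟨?_, fun t => ⟨?_, ?_⟩⟩
  · rw [← Finset.sum_div, Finset.sum_comm, Finset.sum_congr rfl fun i hi => (hy i hi).1,
      Finset.sum_const, nsmul_eq_mul, mul_div_cancel_left₀ _ hc.ne']
  · rw [le_div_iff₀ hc, mul_comm, ← nsmul_eq_mul]
    exact Finset.card_nsmul_le_sum _ _ _ fun i hi => ((hy i hi).2 t).1
  · rw [div_le_iff₀ hc, mul_comm, ← nsmul_eq_mul]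
    exact Finset.sum_le_card_nsmul _ _ _ fun i hi => ((hy i hi).2 t).2

theorem sum_comp_eq_sum_card_fiber_mul {m n : ℕ} (g : Fin m → Fin n) (f : Fin n → ℝ) :
    ∑ i, f (g i) = ∑ ℓ, ((Finset.univ.filter (fun i => g i = ℓ)).card : ℝ) * f ℓ := by
  rw [← Finset.sum_fiberwise Finset.univ g]
  refine Finset.sum_congr rfl fun ℓ _ => ?_
  rw [← nsmul_eq_mul, ← Finset.sum_const]
  exact Finset.sum_congr rfl fun i hi => by rw [(Finset.mem_filter.1 hi).2]

theorem Fsoc_comp (h m n : ℕ) (p x0 : Fin h → ℝ) (g : Fin m → Fin n) (xb : Fin n → Fin h → ℝ) :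
    Fsoc h m p x0 (fun i => xb (g i)) =
      Fbar h n p x0 (fun ℓ => (Finset.univ.filter (fun i => g i = ℓ)).card) xb := by
  unfold Fsoc Fbar
  refine Finset.sum_congr rfl fun t _ => ?_
  rw [sum_comp_eq_sum_card_fiber_mul g fun ℓ => xb ℓ t]

theorem Faux_comp (h m n : ℕ) (p : Fin h → ℝ) (g : Fin m → Fin n) (xb : Fin n → Fin h → ℝ) :
    Faux h m p (fun i => xb (g i)) =
      FbarAux h n p (fun ℓ => (Finset.univ.filter (fun i => g i = ℓ)).card) xb :=
  sum_comp_eq_sum_card_fiber_mul g fun ℓ => ∑ t, p t * (xb ℓ t) ^ 2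

/-- If `yb` carries the group totals of `y`, the reduced social cost of `yb` is the social cost
of `y`. -/
theorem Fbar_eq_Fsoc {h m n : ℕ} (p x0 : Fin h → ℝ) {g : Fin m → Fin n}
    {y : Fin m → Fin h → ℝ} {yb : Fin n → Fin h → ℝ}
    (hyb : ∀ ℓ t, ((Finset.univ.filter (fun i => g i = ℓ)).card : ℝ) * yb ℓ t =
      ∑ i ∈ Finset.univ.filter (fun i => g i = ℓ), y i t) :
    Fbar h n p x0 (fun ℓ => (Finset.univ.filter (fun i => g i = ℓ)).card) yb =
      Fsoc h m p x0 y := by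
  unfold Fsoc Fbar
  refine Finset.sum_congr rfl fun t _ => ?_
  rw [← Finset.sum_fiberwise Finset.univ g, Finset.sum_congr rfl fun ℓ _ => hyb ℓ t]

/-- If `s.card * a` is the total of `f` over `s`, the constant family `a` has the smaller sum of
squares. -/
theorem card_mul_sq_le_sum_sq {ι : Type*} {s : Finset ι} {f : ι → ℝ} {a : ℝ}
    (ha : (s.card : ℝ) * a = ∑ i ∈ s, f i) : (s.card : ℝ) * a ^ 2 ≤ ∑ i ∈ s, f i ^ 2 := by
  have hnonneg : 0 ≤ ∑ i ∈ s, (f i - a) ^ 2 := Finset.sum_nonneg fun i _ => sq_nonneg _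
  have hexpand : ∑ i ∈ s, (f i - a) ^ 2 =
      ∑ i ∈ s, f i ^ 2 - 2 * a * ∑ i ∈ s, f i + s.card * a ^ 2 := by
    rw [Finset.mul_sum, ← nsmul_eq_mul, ← Finset.sum_const, ← Finset.sum_sub_distrib,
      ← Finset.sum_add_distrib]
    exact Finset.sum_congr rfl fun i _ => by ring
  rw [← ha] at hexpand
  linarith

theorem FbarAux_le_Faux {h m n : ℕ} {p : Fin h → ℝ} (hp : ∀ t, 0 ≤ p t) {g : Fin m → Fin n}
    {y : Fin m → Fin h → ℝ} {yb : Fin n → Fin h → ℝ}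
    (hyb : ∀ ℓ t, ((Finset.univ.filter (fun i => g i = ℓ)).card : ℝ) * yb ℓ t =
      ∑ i ∈ Finset.univ.filter (fun i => g i = ℓ), y i t) :
    FbarAux h n p (fun ℓ => (Finset.univ.filter (fun i => g i = ℓ)).card) yb ≤
      Faux h m p y := by
  unfold FbarAux Faux
  rw [← Finset.sum_fiberwise Finset.univ g]
  refine Finset.sum_le_sum fun ℓ _ => ?_
  rw [Finset.sum_comm, Finset.mul_sum]
  refine Finset.sum_le_sum fun t _ => ?_
  rw [← Finset.mul_sum, mul_left_comm]
  exact mul_le_mul_of_nonneg_left (card_mul_sq_le_sum_sq (hyb ℓ t)) (hp t)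

/-- Abstraction into homogeneous groups, auxiliary problem: Suppose `I`
is partitioned into groups `I^ℓ = g⁻¹(ℓ)` of agents sharing the same constraint set
`X̄^ℓ`. If `x̄_a⋆` minimizes the reduced auxiliary objective
`F̄^m(x̄) + Σ_ℓ |I^ℓ| Σ_t pᵗ (x̄^{ℓt})²` over `X̄¹ × ⋯ × X̄ⁿ`, then `x_a⋆` defined by
`x_a^{i,⋆} = x̄_a^{g(i),⋆}` is feasible and minimizes `F^m + F^m_a` over `X`; in
particular agents in the same homogeneous group have identical decision vectors at this
minimizer (the Nash equilibrium when `pᵗ > 0` for all `t`). -/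
theorem stmt_16 (h m n : ℕ) (hh : 0 < h) (hm : 0 < m)
    (p x0 : Fin h → ℝ) (hp : ∀ t, 0 ≤ p t) (hx0 : ∀ t, 0 ≤ x0 t)
    (γb : Fin n → ℝ) (lob hib : Fin n → Fin h → ℝ)
    (hγb : ∀ ℓ, 0 < γb ℓ) (hlob : ∀ ℓ t, 0 ≤ lob ℓ t) (hlhb : ∀ ℓ t, lob ℓ t ≤ hib ℓ t)
    (hXne : ∀ ℓ, (Xset h (γb ℓ) (lob ℓ) (hib ℓ)).Nonempty)
    (g : Fin m → Fin n)
    (xba : Fin n → Fin h → ℝ)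
    (hxba : ∀ ℓ, xba ℓ ∈ Xset h (γb ℓ) (lob ℓ) (hib ℓ))
    (hxbamin : ∀ yb : Fin n → Fin h → ℝ, (∀ ℓ, yb ℓ ∈ Xset h (γb ℓ) (lob ℓ) (hib ℓ)) →
      Fbar h n p x0 (fun ℓ => ((Finset.univ : Finset (Fin m)).filter (fun i => g i = ℓ)).card) xba +
        FbarAux h n p (fun ℓ => ((Finset.univ : Finset (Fin m)).filter (fun i => g i = ℓ)).card) xba ≤
      Fbar h n p x0 (fun ℓ => ((Finset.univ : Finset (Fin m)).filter (fun i => g i = ℓ)).card) yb +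
        FbarAux h n p (fun ℓ => ((Finset.univ : Finset (Fin m)).filter (fun i => g i = ℓ)).card) yb) :
    (∀ i, xba (g i) ∈ Xset h (γb (g i)) (lob (g i)) (hib (g i))) ∧
    (∀ y : Fin m → Fin h → ℝ, (∀ i, y i ∈ Xset h (γb (g i)) (lob (g i)) (hib (g i))) →
      Fsoc h m p x0 (fun i => xba (g i)) + Faux h m p (fun i => xba (g i)) ≤
        Fsoc h m p x0 y + Faux h m p y) := by
  refine ⟨fun i => hxba (g i), fun y hy => ?_⟩
  have hmean : ∀ ℓ, ∃ z ∈ Xset h (γb ℓ) (lob ℓ) (hib ℓ),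
      ∀ t, ((Finset.univ.filter (fun i => g i = ℓ)).card : ℝ) * z t =
        ∑ i ∈ Finset.univ.filter (fun i => g i = ℓ), y i t := by
    intro ℓ
    rcases (Finset.univ.filter (fun i => g i = ℓ)).eq_empty_or_nonempty with hs | hs
    · exact ⟨xba ℓ, hxba ℓ, fun t => by simp [hs]⟩
    · refine ⟨_, mean_mem_Xset hs (y := y) fun i hi => ?_, fun t => ?_⟩
      · simpa only [(Finset.mem_filter.1 hi).2] using hy i
      · exact mul_div_cancel₀ _ (Nat.cast_ne_zero.2 hs.card_pos.ne')
  choose yb hmem htot using hmean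
  rw [Fsoc_comp, Faux_comp]
  calc _ ≤ _ := hxbamin yb hmem
    _ ≤ _ := add_le_add (Fbar_eq_Fsoc p x0 htot).le (FbarAux_le_Faux hp htot)
end

section
/- (Normalized optimal cost identity under a discrete parameter distribution.) Suppose the agents' parameters take values in a finite set {ξ̄^1, …, ξ̄^{n_ξ}}, so that I is partitioned into homogeneous groups I^ℓ = {i ∈ I : ξ^i = ξ̄^ℓ} with common reduced constraint sets X̄^ℓ. Then for any minimizer x⋆ of F^m over X and any minimizer x̄⋆ of the reduced social cost F̄^m over X̄^1 × … × X̄^{n_ξ}, F^m(x⋆)/m² = Σ_{t∈H} p^t (Σ_{ℓ=1}^{n_ξ} (|I^ℓ|/m) x̄^{ℓt,⋆} + x^{0t}/m)². -/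
open Finset in
/-- The average of finitely many points of a constraint set lies in the set. -/
lemma average_mem_Xset {ι : Type*} {h : ℕ} {γ : ℝ} {lo hi : Fin h → ℝ} {s : Finset ι}
    (hs : s.Nonempty) {x : ι → Fin h → ℝ} (hx : ∀ i ∈ s, x i ∈ Xset h γ lo hi) :
    (fun t => (∑ i ∈ s, x i t) / (#s : ℝ)) ∈ Xset h γ lo hi := by
  have hpos : (0 : ℝ) < #s := by exact_mod_cast hs.card_pos
  refine ⟨?_, fun t => ⟨?_, ?_⟩⟩
  · rw [← sum_div, sum_comm, sum_congr rfl fun i hi => (hx i hi).1, sum_const, nsmul_eq_mul,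
      mul_div_cancel_left₀ _ hpos.ne']
  · rw [le_div_iff₀ hpos, mul_comm, ← nsmul_eq_mul]
    exact card_nsmul_le_sum s _ _ fun i hi => ((hx i hi).2 t).1
  · rw [div_le_iff₀ hpos, mul_comm, ← nsmul_eq_mul]
    exact sum_le_card_nsmul s _ _ fun i hi => ((hx i hi).2 t).2

open Finset in
/-- The reduced cost of a profile of groups is the social cost of any profile of agents whose
aggregate over each group is the same. -/
lemma Fbar_card_eq_Fsoc {h m n : ℕ} (p x0 : Fin h → ℝ) (c : Fin m → Fin n)
    {x : Fin m → Fin h → ℝ} {y : Fin n → Fin h → ℝ}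
    (hxy : ∀ ℓ t, (#{i | c i = ℓ} : ℝ) * y ℓ t = ∑ i with c i = ℓ, x i t) :
    Fbar h n p x0 (fun ℓ => #{i | c i = ℓ}) y = Fsoc h m p x0 x := by
  simp only [Fbar, Fsoc, hxy, Finset.sum_fiberwise]

/-- Normalized optimal cost identity under a discrete parameter
distribution: Suppose the agents' parameters `ξⁱ = (γⁱ, x̲ⁱ, x̄ⁱ)` take values in the
finite set `{ξ̄¹, …, ξ̄ⁿ}` (of distinct points), so `I` is partitioned into homogeneous
groups `I^ℓ = {i : ξⁱ = ξ̄^ℓ}` with common reduced constraint sets `X̄^ℓ`. Then for any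
minimizer `x⋆` of `F^m` over `X` and any minimizer `x̄⋆` of the reduced cost `F̄^m` over
`X̄¹ × ⋯ × X̄ⁿ`, `F^m(x⋆)/m² = Σ_t pᵗ (Σ_ℓ (|I^ℓ|/m) x̄^{ℓt,⋆} + x⁰ᵗ/m)²`. -/
theorem stmt_18 (h m n : ℕ) (hh : 0 < h) (hm : 0 < m)
    (p x0 : Fin h → ℝ) (hp : ∀ t, 0 ≤ p t) (hx0 : ∀ t, 0 ≤ x0 t)
    (ξ : Fin m → ℝ × (Fin h → ℝ) × (Fin h → ℝ))
    (ξbar : Fin n → ℝ × (Fin h → ℝ) × (Fin h → ℝ))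
    (hinj : Function.Injective ξbar)
    (hval : ∀ i, ∃ ℓ, ξ i = ξbar ℓ)
    (hγ : ∀ ℓ, 0 < (ξbar ℓ).1)
    (hXne : ∀ ℓ, (Xset h (ξbar ℓ).1 (ξbar ℓ).2.1 (ξbar ℓ).2.2).Nonempty)
    (xs : Fin m → Fin h → ℝ)
    (hxs : ∀ i, xs i ∈ Xset h (ξ i).1 (ξ i).2.1 (ξ i).2.2)
    (hxsmin : ∀ y : Fin m → Fin h → ℝ, (∀ i, y i ∈ Xset h (ξ i).1 (ξ i).2.1 (ξ i).2.2) →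
      Fsoc h m p x0 xs ≤ Fsoc h m p x0 y)
    (xb : Fin n → Fin h → ℝ)
    (hxb : ∀ ℓ, xb ℓ ∈ Xset h (ξbar ℓ).1 (ξbar ℓ).2.1 (ξbar ℓ).2.2)
    (hxbmin : ∀ yb : Fin n → Fin h → ℝ,
      (∀ ℓ, yb ℓ ∈ Xset h (ξbar ℓ).1 (ξbar ℓ).2.1 (ξbar ℓ).2.2) →
      Fbar h n p x0 (fun ℓ => Nat.card {i : Fin m // ξ i = ξbar ℓ}) xb ≤
        Fbar h n p x0 (fun ℓ => Nat.card {i : Fin m // ξ i = ξbar ℓ}) yb) :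
    Fsoc h m p x0 xs / (m : ℝ) ^ 2 =
      ∑ t, p t * ((∑ ℓ, ((Nat.card {i : Fin m // ξ i = ξbar ℓ} : ℝ) / (m : ℝ)) * xb ℓ t) +
        x0 t / (m : ℝ)) ^ 2 := by
  classical
  choose c hc using hval
  have hcnt (ℓ) : Nat.card {i : Fin m // ξ i = ξbar ℓ} = (Finset.univ.filter (c · = ℓ)).card := by
    simp only [hc, hinj.eq_iff, Nat.card_eq_fintype_card, Fintype.card_subtype]
  simp only [hcnt] at hxbmin ⊢
  have hle : Fsoc h m p x0 xs ≤
      Fbar h n p x0 (fun ℓ => (Finset.univ.filter (c · = ℓ)).card) xb := by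
    rw [Fbar_card_eq_Fsoc p x0 c (x := fun i => xb (c i))]
    · exact hxsmin _ fun i => by rw [hc i]; exact hxb (c i)
    · intro ℓ t
      rw [Finset.sum_congr rfl fun i hi => by rw [(Finset.mem_filter.1 hi).2], Finset.sum_const,
        nsmul_eq_mul]
  have hge : Fbar h n p x0 (fun ℓ => (Finset.univ.filter (c · = ℓ)).card) xb ≤
      Fsoc h m p x0 xs := by
    let y : Fin n → Fin h → ℝ := fun ℓ =>
      if (Finset.univ.filter (c · = ℓ)).Nonempty then
        fun t => (∑ i with c i = ℓ, xs i t) / ((Finset.univ.filter (c · = ℓ)).card : ℝ)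
      else xb ℓ
    rw [← Fbar_card_eq_Fsoc p x0 c (x := xs) (y := y)]
    · refine hxbmin y fun ℓ => ?_
      by_cases hne : (Finset.univ.filter (c · = ℓ)).Nonempty
      · simp only [y, if_pos hne]
        refine average_mem_Xset hne fun i hi => ?_
        rw [← (Finset.mem_filter.1 hi).2, ← hc i]
        exact hxs i
      · simp only [y, if_neg hne]
        exact hxb ℓ
    · intro ℓ t
      by_cases hne : (Finset.univ.filter (c · = ℓ)).Nonempty
      · simp only [y, if_pos hne]
        exact mul_div_cancel₀ _ (Nat.cast_ne_zero.2 hne.card_pos.ne')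
      · simp [Finset.not_nonempty_iff_eq_empty.1 hne]
  rw [le_antisymm hle hge, Fbar, Finset.sum_div]
  refine Finset.sum_congr rfl fun t _ => ?_
  simp only [div_mul_eq_mul_div]
  rw [← Finset.sum_div, ← add_div, div_pow, mul_div_assoc]
end
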